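/- Let d ≥ 1 and p ≥ 0, and let N_p = {α ∈ ℕ^d : |α| ≤ p}. The linear map from the space P_p of real polynomials in d variables of total degree at most p to ℝ^{N_p} given by v ↦ (∫_{α+Ŝ} v(x) dx)_{α ∈ N_p} is a linear bijection. -/

import Mathlib

open MeasureTheory

/-- The closed unit simplex `Ŝ = {x ∈ ℝ^d : xᵢ ≥ 0, ∑ xᵢ ≤ 1}`. -/
def unitSimplex (d : ℕ) : Set (Fin d → ℝ) :=
  {x | (∀ i, 0 ≤ x i) ∧ ∑ i, x i ≤ 1}

instance multiIndexFinite (d p : ℕ) : Finite {α : Fin d → ℕ // ∑ i, α i ≤ p} := by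
  have hle : ∀ α : {α : Fin d → ℕ // ∑ i, α i ≤ p}, ∀ i, α.1 i ≤ p := fun α i =>
    le_trans (Finset.single_le_sum (fun j _ => Nat.zero_le (α.1 j)) (Finset.mem_univ i)) α.2
  exact Finite.of_injective
    (fun α => (fun i => (⟨α.1 i, Nat.lt_succ_of_le (hle α i)⟩ : Fin (p + 1))))
    (fun a b h => Subtype.ext (funext fun i => congrArg Fin.val (congrFun h i)))

noncomputable instance multiIndexFintype (d p : ℕ) :
    Fintype {α : Fin d → ℕ // ∑ i, α i ≤ p} := Fintype.ofFinite _

open MvPolynomial in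
/-- Translating the argument of a product of variables changes only its lower order terms. -/
lemma totalDegree_translate_prod_X_sub {R σ : Type*} [CommRing R] (c : σ → R) (m : Multiset σ) :
    aeval (fun j => X j + C (c j)) (m.map (X (R := R))).prod = (m.map X).prod ∨
      (aeval (fun j => X j + C (c j)) (m.map (X (R := R))).prod - (m.map X).prod).totalDegree + 1
        ≤ m.card := by
  nontriviality R
  have hdeg (m : Multiset σ) : (m.map (X (R := R))).prod.totalDegree ≤ m.card := by
    refine (totalDegree_multiset_prod _).trans ?_
    simp
  induction m using Multiset.induction with
  | empty => simp
  | cons i m ih =>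
    right
    simp only [Multiset.map_cons, Multiset.prod_cons, map_mul, aeval_X, Multiset.card_cons,
      add_le_add_iff_right]
    set u := (m.map (X (R := R))).prod with hu
    set t := aeval (fun j => X j + C (c j)) u with ht
    have key : (X i + C (c i)) * t - X i * u = (X i + C (c i)) * (t - u) + C (c i) * u := by ring
    rw [key]
    refine (totalDegree_add _ _).trans (max_le ?_ ?_)
    · rcases ih with h | h
      · simp [h]
      · refine (totalDegree_mul _ _).trans ?_
        have : (X i + C (c i) : MvPolynomial σ R).totalDegree ≤ 1 :=
          (totalDegree_add _ _).trans (by simp)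
        omega
    · refine (totalDegree_mul _ _).trans ?_
      simpa using hdeg m

open MvPolynomial in
/-- Differences of translates of a polynomial have smaller degree. -/
lemma totalDegree_translate_sub_le {R σ : Type*} [CommRing R] (c : σ → R) (p : ℕ)
    (v : MvPolynomial σ R) (hv : v.totalDegree ≤ p + 1) :
    (aeval (fun j => X j + C (c j)) v - v).totalDegree ≤ p := by
  rw [← mem_restrictTotalDegree]
  nth_rewrite 1 2 [v.as_sum]
  rw [map_sum, ← Finset.sum_sub_distrib]
  refine Submodule.sum_mem _ fun s hs => ?_
  have hs' := (le_totalDegree hs).trans hv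
  have hmon : monomial s (coeff s v) = coeff s v • (s.toMultiset.map (X (R := R))).prod := by
    rw [monomial_eq, smul_eq_C_mul, Finsupp.toMultiset_map, Finsupp.prod_toMultiset,
      Finsupp.prod_mapDomain_index (by simp) (by simp [pow_add])]
  rw [hmon, map_smul, ← smul_sub]
  refine Submodule.smul_mem _ _ ?_
  rw [mem_restrictTotalDegree]
  rcases totalDegree_translate_prod_X_sub c s.toMultiset with h | h
  · rw [h, sub_self, totalDegree_zero]
    exact p.zero_le
  · rw [Finsupp.card_toMultiset] at h
    exact Nat.le_of_succ_le_succ (h.trans hs')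

open MvPolynomial in
/-- A polynomial invariant under the unit translations is constant. -/
lemma eq_C_of_eval_add_single {σ : Type*} [DecidableEq σ] (v : MvPolynomial σ ℝ) [Finite σ]
    (h : ∀ (i : σ) (x : σ → ℝ), eval (x + Pi.single i 1) v = eval x v) :
    v = C (eval 0 v) := by
  have hnat (n : σ →₀ ℕ) (x : σ → ℝ) : eval (x + fun i => (n i : ℝ)) v = eval x v := by
    induction n using Finsupp.induction_linear generalizing x with
    | zero => congr 2; ext; simp
    | add f g hf hg =>
      rw [← hf x, ← hg (x + fun i => (f i : ℝ))]
      congr 2; ext i; simp [add_assoc]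
    | single i k =>
      induction k with
      | zero => congr 2; ext; simp
      | succ k ih =>
        rw [← ih, ← h i (x + fun j => (Finsupp.single i k j : ℝ))]
        congr 2; ext j
        by_cases hj : j = i
        · subst hj; simp [add_assoc]
        · simp [hj, Finsupp.single_apply, Ne.symm hj]
  refine funext_set (fun _ => Set.range ((↑) : ℕ → ℝ))
    (fun _ => Set.infinite_range_of_injective Nat.cast_injective) fun x hx => ?_
  choose n hn using fun i => hx i (Set.mem_univ i)
  rw [eval_C, ← hnat (Finsupp.equivFunOnFinite.symm n) 0]
  congr 2; ext i; simp [← hn i]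

lemma isCompact_unitSimplex (d : ℕ) : IsCompact (unitSimplex d) := by
  refine (isCompact_Icc (a := (0 : Fin d → ℝ)) (b := 1)).of_isClosed_subset ?_ ?_
  · refine IsClosed.inter (s₁ := {x : Fin d → ℝ | ∀ i, 0 ≤ x i})
      (s₂ := {x : Fin d → ℝ | ∑ i, x i ≤ 1}) ?_ ?_
    · simp only [Set.ofPred_forall]
      exact isClosed_iInter fun i => isClosed_le continuous_const (continuous_apply i)
    · exact isClosed_le (by fun_prop) continuous_const
  · exact fun x hx => ⟨hx.1, fun i =>
      (Finset.single_le_sum (fun j _ => hx.1 j) (Finset.mem_univ i)).trans hx.2⟩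

lemma volume_unitSimplex_pos (d : ℕ) : 0 < volume (unitSimplex d) := by
  have hsub : Set.univ.pi (fun _ : Fin d => Set.Ioo (0 : ℝ) (1 / (d + 1))) ⊆ unitSimplex d := by
    intro x hx
    refine ⟨fun i => (hx i (Set.mem_univ i)).1.le, ?_⟩
    calc ∑ i, x i ≤ ∑ _i : Fin d, (1 / (d + 1) : ℝ) :=
          Finset.sum_le_sum fun i _ => (hx i (Set.mem_univ i)).2.le
      _ ≤ 1 := by
          simp only [Finset.sum_const, Finset.card_univ, Fintype.card_fin, nsmul_eq_mul]
          rw [mul_one_div, div_le_one (by positivity)]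
          linarith
  refine lt_of_lt_of_le ?_ (measure_mono hsub)
  refine (isOpen_set_pi Set.finite_univ fun _ _ => isOpen_Ioo).measure_pos _
    ⟨fun _ => 1 / (d + 1) / 2, fun i _ => ⟨by positivity, half_lt_self (by positivity)⟩⟩

/-- The integral of a polynomial over the translate `a + Ŝ`, as a linear map. -/
noncomputable def simplexIntegral {d : ℕ} (a : Fin d → ℝ) : MvPolynomial (Fin d) ℝ →ₗ[ℝ] ℝ where
  toFun v := ∫ y in unitSimplex d, MvPolynomial.eval (a + y) v
  map_add' u v := by
    simp only [map_add]
    exact integral_add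
      (((MvPolynomial.continuous_eval _).comp (continuous_const_add a)).continuousOn.integrableOn_compact (isCompact_unitSimplex d))
      (((MvPolynomial.continuous_eval _).comp (continuous_const_add a)).continuousOn.integrableOn_compact (isCompact_unitSimplex d))
  map_smul' r v := by
    simp only [MvPolynomial.smul_eval, RingHom.id_apply, smul_eq_mul]
    exact integral_const_mul _ _

lemma simplexIntegral_apply {d : ℕ} (a : Fin d → ℝ) (v : MvPolynomial (Fin d) ℝ) :
    simplexIntegral a v = ∫ y in unitSimplex d, MvPolynomial.eval (a + y) v := rfl

lemma simplexIntegral_C {d : ℕ} (a : Fin d → ℝ) (r : ℝ) :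
    simplexIntegral a (MvPolynomial.C r) = volume.real (unitSimplex d) * r := by
  simp [simplexIntegral_apply]

open MvPolynomial in
lemma eval_translate {d : ℕ} (c x : Fin d → ℝ) (v : MvPolynomial (Fin d) ℝ) :
    eval x (aeval (fun j => X j + C (c j)) v) = eval (x + c) v := by
  rw [← coe_aeval_eq_eval, ← coe_aeval_eq_eval, RingHom.coe_coe, RingHom.coe_coe,
    ← AlgHom.comp_apply, comp_aeval]
  congr 2
  ext j
  simp

open MvPolynomial in
/-- A polynomial of degree at most `p` with vanishing integrals over all simplices `α + Ŝ`,
`|α| ≤ p`, is zero. -/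
lemma eq_zero_of_simplexIntegral_eq_zero {d : ℕ} (p : ℕ) (v : MvPolynomial (Fin d) ℝ)
    (hv : v.totalDegree ≤ p)
    (h : ∀ α : Fin d → ℕ, ∑ i, α i ≤ p → simplexIntegral (fun i => (α i : ℝ)) v = 0) :
    v = 0 := by
  have hpos : volume.real (unitSimplex d) ≠ 0 :=
    (ENNReal.toReal_pos (volume_unitSimplex_pos d).ne'
      (isCompact_unitSimplex d).measure_lt_top.ne).ne'
  induction p generalizing v with
  | zero =>
    rw [totalDegree_eq_zero_iff_eq_C.mp (Nat.le_zero.mp hv)] at h ⊢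
    have h0 := h 0 (by simp)
    rw [simplexIntegral_C] at h0
    rw [(mul_eq_zero.mp h0).resolve_left hpos, C_0]
  | succ p ih =>
    have hper (i : Fin d) (x : Fin d → ℝ) : eval (x + Pi.single i 1) v = eval x v := by
      have hdiff := ih _ (totalDegree_translate_sub_le (Pi.single i 1) p v hv) fun α hα => by
        have h1 := h α (hα.trans p.le_succ)
        have h2 := h (α + Pi.single i 1) (by simp [Finset.sum_add_distrib, hα])
        rw [map_sub, h1, sub_zero, ← h2, simplexIntegral_apply, simplexIntegral_apply]
        refine integral_congr_ae (.of_forall fun y => ?_)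
        simp only [eval_translate]
        congr 2
        ext j
        by_cases hj : j = i
        · subst hj; simp; ring
        · simp [hj]
      rw [← eval_translate, sub_eq_zero.mp hdiff]
    rw [eq_C_of_eval_add_single v hper] at h ⊢
    have h0 := h 0 (by simp)
    rw [simplexIntegral_C] at h0
    rw [(mul_eq_zero.mp h0).resolve_left hpos, C_0]

lemma finrank_restrictTotalDegree (d p : ℕ) :
    Module.finrank ℝ (MvPolynomial.restrictTotalDegree (Fin d) ℝ p) =
      Module.finrank ℝ ({α : Fin d → ℕ // ∑ i, α i ≤ p} → ℝ) := by
  rw [Module.finrank_fintype_fun_eq_card, ← Nat.card_eq_fintype_card,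
    MvPolynomial.restrictTotalDegree,
    Module.finrank_eq_nat_card_basis (MvPolynomial.basisRestrictSupport ℝ _)]
  refine Nat.card_congr (Finsupp.equivFunOnFinite.subtypeEquiv fun n => ?_)
  simp [Finsupp.sum_fintype]

/-- The linear map sending a polynomial of total degree at most `p` to the vector of its
integrals over the translates `α + Ŝ`, `α ∈ N_p`, of the unit simplex is a linear bijection. -/
theorem averages_linearEquiv
    (d p : ℕ) (hd : 1 ≤ d) :
    ∃ e : MvPolynomial.restrictTotalDegree (Fin d) ℝ p ≃ₗ[ℝ]
        ({α : Fin d → ℕ // ∑ i, α i ≤ p} → ℝ),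
      ∀ (v : MvPolynomial.restrictTotalDegree (Fin d) ℝ p)
        (α : {α : Fin d → ℕ // ∑ i, α i ≤ p}),
        e v α = ∫ x in (fun y : Fin d → ℝ => fun i => (α.1 i : ℝ) + y i) '' unitSimplex d,
          MvPolynomial.eval x (v : MvPolynomial (Fin d) ℝ) ∂volume := by
  let f : MvPolynomial.restrictTotalDegree (Fin d) ℝ p →ₗ[ℝ]
      ({α : Fin d → ℕ // ∑ i, α i ≤ p} → ℝ) :=
    LinearMap.pi fun α =>
      simplexIntegral (fun i => (α.1 i : ℝ)) ∘ₗ Submodule.subtype _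
  have hf : Function.Injective f := by
    rw [injective_iff_map_eq_zero]
    exact fun v hv => Subtype.ext (eq_zero_of_simplexIntegral_eq_zero p v
      ((MvPolynomial.mem_restrictTotalDegree _ _ _).mp v.2)
      fun α hα => congrFun hv ⟨α, hα⟩)
  refine ⟨f.linearEquivOfInjective hf (finrank_restrictTotalDegree d p), fun v α => ?_⟩
  exact ((measurePreserving_add_left volume fun i => (α.1 i : ℝ)).setIntegral_image_emb
    (measurableEmbedding_addLeft _)
    (fun x => MvPolynomial.eval x (v : MvPolynomial (Fin d) ℝ)) _).symm
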